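/- Let ρ₁ ∈ (0, 1/2] and let h : [0,1] → [0,1] satisfy h(0) = h(1) = 0, h(x) > 0 for all x ∈ (0,1), and h(x²) + h(2x − x²) ≤ 2^(1−ρ₁)·h(x) for all x ∈ (0,1). Let α ∈ (0, 1/2), δ ∈ (0,1), ε₁, ε₂ ∈ (0,1) and c₃ ≥ 0 be such that t(x) ≤ 2^(−ρ₁) for all x ∈ [0, ε₁] ∪ [1 − ε₂, 1], and (x(1−x))^α ≤ c₃·h(x) for all x ∈ (ε₁, 1 − ε₂), where t(x) = (1/2)·((x(1+x))^α + ((2−x)(1−x)^{1/3})^α). Then for every z ∈ [0,1] and every n ≥ 0, the BEC Bhattacharyya process (Z_n) with initial value z satisfies E[(Z_n(1 − Z_n))^α] ≤ (1/δ)·(2^(−ρ₁) + √2·(δ/(1−δ))·c₃)^n. -/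

import Mathlib

/-- One polarization step for the Bhattacharyya parameter of a BEC. -/
noncomputable def becStep (z : ℝ) (b : Bool) : ℝ := if b then z ^ 2 else 2 * z - z ^ 2

/-- `becF n b z` is the Bhattacharyya parameter of the synthetic channel indexed by the
binary string `b` obtained by polarizing a BEC with erasure probability `z`. -/
noncomputable def becF (n : ℕ) (b : Fin n → Bool) (z : ℝ) : ℝ :=
  (List.ofFn b).foldl becStep z

lemma bec_sum_succ (n : ℕ) (V : ℝ → ℝ) (z : ℝ) :
    ∑ b : Fin (n + 1) → Bool, V (becF (n + 1) b z) =
      (∑ b : Fin n → Bool, V (becF n b (z ^ 2))) +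
        ∑ b : Fin n → Bool, V (becF n b (2 * z - z ^ 2)) := by
  rw [← (Fin.consEquiv (fun _ : Fin (n + 1) => Bool)).sum_comp, Fintype.sum_prod_type]
  simp [becF, becStep, Fin.consEquiv, List.ofFn_succ]

lemma bec_sum_le (V : ℝ → ℝ) (lam : ℝ) (hlam : 0 ≤ lam)
    (hV : ∀ x ∈ Set.Icc (0:ℝ) 1, V (x ^ 2) + V (2 * x - x ^ 2) ≤ 2 * lam * V x) (n : ℕ) :
    ∀ z ∈ Set.Icc (0:ℝ) 1, ∑ b : Fin n → Bool, V (becF n b z) ≤ (2 * lam) ^ n * V z := by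
  induction n with
  | zero => intro z _; simp [becF]
  | succ n ih =>
    intro z hz
    rw [bec_sum_succ]
    obtain ⟨hz0, hz1⟩ := hz
    have e1 := ih (z ^ 2) ⟨by positivity, by nlinarith⟩
    have e2 := ih (2 * z - z ^ 2) ⟨by nlinarith, by nlinarith [sq_nonneg (1 - z)]⟩
    have e3 := mul_le_mul_of_nonneg_left (hV z ⟨hz0, hz1⟩)
      (show 0 ≤ (2 * lam) ^ n by positivity)
    calc _ ≤ (2 * lam) ^ n * (V (z ^ 2) + V (2 * z - z ^ 2)) := by linarith
      _ ≤ _ := e3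
      _ = _ := by ring

lemma becF_mem (n : ℕ) : ∀ (b : Fin n → Bool) (z : ℝ), z ∈ Set.Icc (0:ℝ) 1 →
    becF n b z ∈ Set.Icc (0:ℝ) 1 := by
  induction n with
  | zero => intro b z hz; simpa [becF] using hz
  | succ n ih =>
    intro b z hz
    have : becF (n + 1) b z = becF n (fun i => b i.succ) (becStep z (b 0)) := by
      simp [becF, List.ofFn_succ]
    rw [this]
    apply ih
    obtain ⟨hz0, hz1⟩ := hz
    unfold becStep
    split
    · exact ⟨by positivity, by nlinarith⟩
    · exact ⟨by nlinarith, by nlinarith [sq_nonneg (1 - z)]⟩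

/-- **From eigenfunction to expectation (BEC).**
Under the stated hypotheses on `ρ₁`, `h`, `α`, `δ`, `ε₁`, `ε₂`, `c₃` and the auxiliary
function `t(x) = (1/2)·((x(1+x))^α + ((2−x)(1−x)^{1/3})^α)`, for every `z ∈ [0,1]` and
every `n ≥ 0` the BEC Bhattacharyya process with initial value `z` satisfies
`E[(Z_n(1 − Z_n))^α] ≤ (1/δ)·(2^(−ρ₁) + √2·(δ/(1−δ))·c₃)^n`, where the expectation is
the uniform average over the `2^n` binary strings of length `n`. -/
theorem bec_eigenfunction_to_expectation
    (ρ₁ : ℝ) (hρ₁ : ρ₁ ∈ Set.Ioc (0:ℝ) (1/2))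
    (h : ℝ → ℝ)
    (hmap : ∀ x ∈ Set.Icc (0:ℝ) 1, h x ∈ Set.Icc (0:ℝ) 1)
    (h0 : h 0 = 0) (h1 : h 1 = 0)
    (hpos : ∀ x ∈ Set.Ioo (0:ℝ) 1, 0 < h x)
    (hsup : ∀ x ∈ Set.Ioo (0:ℝ) 1,
      h (x ^ 2) + h (2 * x - x ^ 2) ≤ (2:ℝ) ^ (1 - ρ₁) * h x)
    (α : ℝ) (hα : α ∈ Set.Ioo (0:ℝ) (1/2))
    (δ : ℝ) (hδ : δ ∈ Set.Ioo (0:ℝ) 1)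
    (ε₁ : ℝ) (hε₁ : ε₁ ∈ Set.Ioo (0:ℝ) 1)
    (ε₂ : ℝ) (hε₂ : ε₂ ∈ Set.Ioo (0:ℝ) 1)
    (c₃ : ℝ) (hc₃ : 0 ≤ c₃)
    (ht : ∀ x ∈ Set.Icc (0:ℝ) ε₁ ∪ Set.Icc (1 - ε₂) 1,
      (1/2) * ((x * (1 + x)) ^ α + ((2 - x) * (1 - x) ^ ((1:ℝ)/3)) ^ α) ≤ (2:ℝ) ^ (-ρ₁))
    (hc : ∀ x ∈ Set.Ioo ε₁ (1 - ε₂), (x * (1 - x)) ^ α ≤ c₃ * h x) :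
    ∀ z ∈ Set.Icc (0:ℝ) 1, ∀ n : ℕ,
      (∑ b : Fin n → Bool, (becF n b z * (1 - becF n b z)) ^ α) / 2 ^ n ≤
        (1/δ) * ((2:ℝ) ^ (-ρ₁) + Real.sqrt 2 * (δ / (1 - δ)) * c₃) ^ n := by
  obtain ⟨hα0, hα1⟩ := hα
  obtain ⟨hδ0, hδ1⟩ := hδ
  intro z hz n
  set r : ℝ := (2:ℝ) ^ (-ρ₁) with hr
  have hr0 : 0 < r := by positivity
  have hr2 : (2:ℝ) ^ (1 - ρ₁) = 2 * r := by
    rw [sub_eq_add_neg, Real.rpow_add (by norm_num), Real.rpow_one]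
  have h1δ : 0 < 1 - δ := by linarith
  set s : ℝ := Real.sqrt 2 with hs
  have hs0 : 0 ≤ s := Real.sqrt_nonneg 2
  set lam : ℝ := r + s * (δ / (1 - δ)) * c₃ with hlam
  have hlam0 : 0 ≤ lam := by positivity
  set g : ℝ → ℝ := fun x => (x * (1 - x)) ^ α with hg
  have hg0 : ∀ x ∈ Set.Icc (0:ℝ) 1, 0 ≤ g x := fun x hx =>
    Real.rpow_nonneg (mul_nonneg hx.1 (by linarith [hx.2])) _
  have hg1 : ∀ x ∈ Set.Icc (0:ℝ) 1, g x ≤ 1 := fun x hx =>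
    Real.rpow_le_one (mul_nonneg hx.1 (by linarith [hx.2])) (by nlinarith [hx.1, hx.2]) hα0.le
  have gz : g 0 = 0 := by simp [hg, Real.zero_rpow hα0.ne']
  have go : g 1 = 0 := by simp [hg, Real.zero_rpow hα0.ne']
  have h2s : ∀ y : ℝ, 0 ≤ y → y ≤ 2 → y ^ α ≤ s := by
    intro y hy hy2
    calc y ^ α ≤ 2 ^ α := Real.rpow_le_rpow hy hy2 hα0.le
      _ ≤ 2 ^ ((1:ℝ)/2) := Real.rpow_le_rpow_of_exponent_le (by norm_num) hα1.le
      _ = s := by rw [hs, Real.sqrt_eq_rpow]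
  have key : ∀ x ∈ Set.Icc (0:ℝ) 1,
      δ * g (x ^ 2) + (1 - δ) * h (x ^ 2) + (δ * g (2 * x - x ^ 2) + (1 - δ) * h (2 * x - x ^ 2))
        ≤ 2 * lam * (δ * g x + (1 - δ) * h x) := by
    intro x hx
    rcases hx.1.eq_or_lt with hx0 | hx0
    · subst hx0; norm_num [gz, h0]
    rcases hx.2.eq_or_lt with hx1 | hx1
    · subst hx1; norm_num [go, h1]
    have hH := hsup x ⟨hx0, hx1⟩
    rw [hr2] at hH
    have hhx := hpos x ⟨hx0, hx1⟩
    have hgx := hg0 x hx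
    have hxx : 0 ≤ x * (1 - x) := mul_nonneg hx.1 (by linarith)
    have hA0 : 0 ≤ x * (1 + x) := by positivity
    have hB0 : 0 ≤ (2 - x) * (1 - x) := mul_nonneg (by linarith) (by linarith)
    have e1 : g (x ^ 2) = g x * (x * (1 + x)) ^ α := by
      simp only [hg]; rw [← Real.mul_rpow hxx hA0]; congr 1; ring
    have e2 : g (2 * x - x ^ 2) = g x * ((2 - x) * (1 - x)) ^ α := by
      simp only [hg]; rw [← Real.mul_rpow hxx hB0]; congr 1; ring
    have hG : g (x ^ 2) + g (2 * x - x ^ 2) ≤ 2 * r * g x + 2 * s * c₃ * h x := by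
      rw [e1, e2]
      by_cases hm : x ∈ Set.Ioo ε₁ (1 - ε₂)
      · have a1 := h2s _ hA0 (by nlinarith)
        have a2 := h2s _ hB0 (by nlinarith)
        have a3 : g x ≤ c₃ * h x := hc x hm
        have b1 := mul_le_mul_of_nonneg_left a1 hgx
        have b2 := mul_le_mul_of_nonneg_left a2 hgx
        have b3 := mul_le_mul_of_nonneg_left a3 hs0
        have b4 := mul_nonneg hr0.le hgx
        nlinarith
      · have hmem : x ∈ Set.Icc (0:ℝ) ε₁ ∪ Set.Icc (1 - ε₂) 1 := by
          by_cases hx' : x ≤ ε₁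
          · exact Or.inl ⟨hx.1, hx'⟩
          · refine Or.inr ⟨?_, hx.2⟩
            by_contra hcon
            exact hm ⟨not_le.mp hx', not_le.mp hcon⟩
        have a1 := ht x hmem
        have a2 : ((2 - x) * (1 - x)) ^ α ≤ ((2 - x) * (1 - x) ^ ((1:ℝ)/3)) ^ α := by
          apply Real.rpow_le_rpow hB0 _ hα0.le
          apply mul_le_mul_of_nonneg_left _ (by linarith)
          exact Real.self_le_rpow_of_le_one (by linarith) (by linarith) (by norm_num)
        have a3 : (x * (1 + x)) ^ α + ((2 - x) * (1 - x)) ^ α ≤ 2 * r := by linarith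
        have b1 := mul_le_mul_of_nonneg_left a3 hgx
        have b2 : 0 ≤ 2 * s * c₃ * h x := by positivity
        nlinarith
    have c1 := mul_le_mul_of_nonneg_left hG hδ0.le
    have c2 := mul_le_mul_of_nonneg_left hH h1δ.le
    have c3 : 2 * lam * (δ * g x + (1 - δ) * h x) =
        2 * r * (δ * g x + (1 - δ) * h x) + 2 * s * c₃ * δ * h x
          + 2 * (s * (δ / (1 - δ)) * c₃) * (δ * g x) := by
      rw [hlam]; field_simp; ring
    have c4 : 0 ≤ 2 * (s * (δ / (1 - δ)) * c₃) * (δ * g x) := by positivity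
    rw [c3]
    linarith
  have main := bec_sum_le (fun x => δ * g x + (1 - δ) * h x) lam hlam0 key n z hz
  have hVz : δ * g z + (1 - δ) * h z ≤ 1 := by
    nlinarith [hg1 z hz, (hmap z hz).2]
  have hle : δ * ∑ b : Fin n → Bool, g (becF n b z) ≤ (2 * lam) ^ n := by
    rw [Finset.mul_sum]
    calc _ ≤ ∑ b : Fin n → Bool, (δ * g (becF n b z) + (1 - δ) * h (becF n b z)) := by
          apply Finset.sum_le_sum
          intro b _
          have := mul_nonneg h1δ.le (hmap _ (becF_mem n b z hz)).1
          linarith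
      _ ≤ _ := main
      _ ≤ (2 * lam) ^ n * 1 := mul_le_mul_of_nonneg_left hVz (by positivity)
      _ = _ := mul_one _
  rw [mul_pow] at hle
  change (∑ b : Fin n → Bool, g (becF n b z)) / 2 ^ n ≤ 1 / δ * lam ^ n
  rw [div_le_iff₀ (by positivity), one_div, mul_assoc, inv_mul_eq_div, le_div_iff₀ hδ0]
  linarith
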